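/- For every integer d ≥ 3 there exists a constant C_d > 0 such that for all integers n ≥ d+1 one has Δ_{d,d}(n) ≤ C_d · n^{6 − ln d}, where ln denotes the natural logarithm; equivalently, every n-element subset of [0,1]^d contains d+1 points spanning a simplex of d-dimensional volume at most C_d · n^{−ln d + 6}. -/

import Mathlib

open scoped RealInnerProductSpace

/-- The Gram matrix of a collection of `k` vectors in `ℝ^d`. -/
noncomputable def gram {d k : ℕ} (v : Fin k → EuclideanSpace ℝ (Fin d)) :
    Matrix (Fin k) (Fin k) ℝ :=
  Matrix.of fun i j => ⟪v i, v j⟫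

/-- `vol v` is the `k`-dimensional volume of the parallelepiped spanned by
`v 1, …, v k`, i.e. the square root of the determinant of their Gram matrix.
For `k = 0` it equals `1`. -/
noncomputable def vol {d k : ℕ} (v : Fin k → EuclideanSpace ℝ (Fin d)) : ℝ :=
  Real.sqrt (gram v).det

/-- The `k`-dimensional volume of the simplex with vertices `p 0, …, p k`. -/
noncomputable def simplexVol {d k : ℕ} (p : Fin (k + 1) → EuclideanSpace ℝ (Fin d)) : ℝ :=
  (Nat.factorial k : ℝ)⁻¹ * vol (fun i : Fin k => p i.succ - p 0)

/-- The minimum, over all `(k+1)`-element subsets of `X`, of the `k`-dimensional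
volume of the simplex they span. -/
noncomputable def minSimplexVol (d k : ℕ) (X : Finset (EuclideanSpace ℝ (Fin d))) : ℝ :=
  sInf { v : ℝ | ∃ p : Fin (k + 1) → EuclideanSpace ℝ (Fin d),
    Function.Injective p ∧ (∀ i, p i ∈ X) ∧ v = simplexVol p }

/-- `Delta k d n` is the supremum, over all `n`-element subsets `X` of the unit cube
`[0,1]^d`, of the minimum `k`-dimensional simplex volume among `(k+1)`-element
subsets of `X`. -/
noncomputable def Delta (k d n : ℕ) : ℝ :=
  sSup { v : ℝ | ∃ X : Finset (EuclideanSpace ℝ (Fin d)), X.card = n ∧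
    (∀ x ∈ X, ∀ i, x i ∈ Set.Icc (0 : ℝ) 1) ∧ v = minSimplexVol d k X }

theorem abs_det_le_factorial_mul_prod {s : ℕ} (A : Matrix (Fin s) (Fin s) ℝ) (r : Fin s → ℝ)
    (h : ∀ i j, |A i j| ≤ r i) : |A.det| ≤ s.factorial * ∏ i, r i := by
  rw [Matrix.det_apply']
  refine (Finset.abs_sum_le_sum_abs _ _).trans ?_
  calc ∑ σ : Equiv.Perm (Fin s), |((Equiv.Perm.sign σ : ℤ) : ℝ) * ∏ i, A (σ i) i|
      ≤ ∑ _σ : Equiv.Perm (Fin s), ∏ i, r i := by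
        refine Finset.sum_le_sum fun σ _ => ?_
        have hs : |((Equiv.Perm.sign σ : ℤ) : ℝ)| = 1 := by
          rcases Int.units_eq_one_or (Equiv.Perm.sign σ) with h | h <;> simp [h]
        rw [abs_mul, hs, one_mul, Finset.abs_prod, ← Equiv.prod_comp σ r]
        exact Finset.prod_le_prod (fun _ _ => abs_nonneg _) fun i _ => h _ _
    _ = _ := by simp [Fintype.card_perm]

theorem abs_det_le_of_rows_close {a : ℕ} (A : Matrix (Fin (a + 1)) (Fin (a + 1)) ℝ) {R r : ℝ}
    (h0 : ∀ j, |A 0 j| ≤ R) (h : ∀ (i : Fin a) j, |A i.succ j - A 0 j| ≤ r) :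
    |A.det| ≤ (a + 1).factorial * (R * r ^ a) := by
  let B : Matrix (Fin (a + 1)) (Fin (a + 1)) ℝ :=
    Matrix.of (Fin.cons (A 0) fun i j => A i.succ j - A 0 j)
  have hAB : A.det = B.det := by
    refine Matrix.det_eq_of_forall_row_eq_smul_add_const (Fin.cons 0 fun _ => 1) 0 rfl
      fun i j => ?_
    refine Fin.cases ?_ (fun i => ?_) i <;> simp [B]
  rw [hAB]
  refine (abs_det_le_factorial_mul_prod B (Fin.cons R fun _ => r) fun i j => ?_).trans_eq ?_
  · refine Fin.cases ?_ (fun i => ?_) i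
    · simpa [B] using h0 j
    · simpa [B] using h i j
  · simp [Fin.prod_univ_succ]

theorem vol_eq_abs_det {d : ℕ} (b : OrthonormalBasis (Fin d) ℝ (EuclideanSpace ℝ (Fin d)))
    (v : Fin d → EuclideanSpace ℝ (Fin d)) :
    vol v = |(Matrix.of fun i j => ⟪v i, b j⟫).det| := by
  have h : gram v = (Matrix.of fun i j => ⟪v i, b j⟫) *
      (Matrix.of fun i j => ⟪v i, b j⟫).transpose := by
    ext i k
    simp only [gram, Matrix.of_apply, Matrix.mul_apply, Matrix.transpose_apply]
    rw [← b.sum_inner_mul_inner]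
    simp only [real_inner_comm]
  rw [vol, h, Matrix.det_mul, Matrix.det_transpose, Real.sqrt_mul_self_eq_abs]

theorem vol_le_factorial_mul_pow {d : ℕ} {R : ℝ} (v : Fin d → EuclideanSpace ℝ (Fin d))
    (hv : ∀ i, ‖v i‖ ≤ R) : vol v ≤ d.factorial * R ^ d := by
  let b := EuclideanSpace.basisFun (Fin d) ℝ
  rw [vol_eq_abs_det b]
  refine (abs_det_le_factorial_mul_prod _ (fun _ => R) fun i j => ?_).trans_eq (by simp)
  exact (abs_real_inner_le_norm (v i) (b j)).trans (by simpa using hv i)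

/-- Appending to a cluster of vectors `u` a family `w` multiplies the volume of a suitable
projection of `w` by at most the volume of the cluster. -/
theorem exists_projection_vol_append_le {a d : ℕ} {R r : ℝ}
    (u : Fin (a + 1) → EuclideanSpace ℝ (Fin (a + 1 + d)))
    (h0 : ‖u 0‖ ≤ R) (h : ∀ i : Fin a, ‖u i.succ - u 0‖ ≤ r) :
    ∃ π : EuclideanSpace ℝ (Fin (a + 1 + d)) → EuclideanSpace ℝ (Fin d),
      (∀ x, ‖π x‖ ≤ ‖x‖) ∧ ∀ w : Fin d → EuclideanSpace ℝ (Fin (a + 1 + d)),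
        vol (Fin.append u w) ≤ (a + 1).factorial * (R * r ^ a) * vol (π ∘ w) := by
  let b : OrthonormalBasis (Fin (a + 1 + d)) ℝ (EuclideanSpace ℝ (Fin (a + 1 + d))) :=
    InnerProductSpace.gramSchmidtOrthonormalBasis (by simp) (Fin.append u 0)
  have hb : ∀ i j, ⟪u i, b (Fin.natAdd (a + 1) j)⟫ = 0 := by
    intro i j
    have := InnerProductSpace.gramSchmidtOrthonormalBasis_inv_triangular (𝕜 := ℝ)
      (E := EuclideanSpace ℝ (Fin (a + 1 + d))) (by simp) (Fin.append u 0)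
      (i := Fin.castAdd d i) (j := Fin.natAdd (a + 1) j)
      (by simp only [Fin.lt_def, Fin.val_castAdd, Fin.val_natAdd]; omega)
    rw [Fin.append_left] at this
    rwa [real_inner_comm]
  refine ⟨fun x => WithLp.toLp 2 fun j => ⟪x, b (Fin.natAdd (a + 1) j)⟫, fun x => ?_, fun w => ?_⟩
  · rw [← sq_le_sq₀ (norm_nonneg _) (norm_nonneg _), ← b.sum_sq_norm_inner_left x,
      EuclideanSpace.norm_sq_eq, Fin.sum_univ_add]
    exact le_add_of_nonneg_left (by positivity)
  · rw [vol_eq_abs_det b, vol_eq_abs_det (EuclideanSpace.basisFun (Fin d) ℝ),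
      ← Matrix.det_submatrix_equiv_self finSumFinEquiv]
    have hblock : (Matrix.of fun i j => ⟪Fin.append u w i, b j⟫).submatrix
        finSumFinEquiv finSumFinEquiv = Matrix.fromBlocks
          (Matrix.of fun i j => ⟪u i, b (Fin.castAdd d j)⟫) 0
          (Matrix.of fun i j => ⟪w i, b (Fin.castAdd d j)⟫)
          (Matrix.of fun i j => ⟪w i, b (Fin.natAdd (a + 1) j)⟫) := by
      ext i j
      rcases i with i | i <;> rcases j with j | j <;> simp [hb]
    rw [hblock, Matrix.det_fromBlocks_zero₁₂, abs_mul]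
    have hle : ∀ (x : EuclideanSpace ℝ (Fin (a + 1 + d))) j, |⟪x, b j⟫| ≤ ‖x‖ := fun x j =>
      (abs_real_inner_le_norm _ _).trans (by simp)
    refine mul_le_mul (abs_det_le_of_rows_close _ (fun j => ?_) fun i j => ?_) (le_of_eq ?_)
      (abs_nonneg _) ?_
    · exact (hle _ _).trans h0
    · simp only [Matrix.of_apply]
      rw [← inner_sub_left]
      exact (hle _ _).trans (h i)
    · congr 2
      ext i j
      simp [EuclideanSpace.inner_single_right]
    · have hR := (norm_nonneg _).trans h0
      rcases Nat.eq_zero_or_pos a with rfl | ha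
      · simpa using hR
      · have := (norm_nonneg _).trans (h ⟨0, ha⟩)
        positivity

theorem EuclideanSpace.norm_le_card_mul {d : ℕ} {r : ℝ} (hr : 0 ≤ r)
    (x : EuclideanSpace ℝ (Fin d)) (hx : ∀ j, |x j| ≤ r) : ‖x‖ ≤ d * r := by
  rw [← sq_le_sq₀ (norm_nonneg _) (by positivity), EuclideanSpace.norm_sq_eq]
  calc ∑ j, ‖x j‖ ^ 2 ≤ ∑ _j : Fin d, r ^ 2 := by
        gcongr with j
        simpa using hx j
    _ = d * r ^ 2 := by simp
    _ ≤ (d * r) ^ 2 := by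
        rw [mul_pow]
        gcongr
        exact_mod_cast Nat.le_self_pow two_ne_zero d

theorem exists_injective_cluster {d R : ℕ} (hd : 0 < d) (hR : 0 < R) (a : ℕ) {ι : Type*}
    (S : Finset ι) (x : ι → EuclideanSpace ℝ (Fin d)) (hx : ∀ i ∈ S, ‖x i‖ ≤ R) {M : ℝ}
    (hM : 1 ≤ M) (hS : ((a + 1) * (6 * R) ^ d : ℝ) * M ≤ S.card) :
    ∃ g : Fin (a + 1) → ι, Function.Injective g ∧ (∀ i, g i ∈ S) ∧
      ∀ i j, ‖x (g i) - x (g j)‖ ≤ d * M ^ (-(d : ℝ)⁻¹) := by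
  classical
  have hM0 : 0 < M := by linarith
  have hd' : (d : ℝ) ≠ 0 := by positivity
  set t : ℝ := M ^ ((d : ℝ)⁻¹) with ht
  have ht1 : 1 ≤ t := Real.one_le_rpow hM (by positivity)
  have htd : t ^ d = M := Real.rpow_inv_natCast_pow hM0.le hd.ne'
  set m : ℕ := ⌈t⌉₊ with hm
  have htm : t ≤ m := Nat.le_ceil t
  have hm2 : (m : ℝ) ≤ 2 * t := by
    have := Nat.ceil_lt_add_one (by linarith : 0 ≤ t)
    linarith
  have hm1 : (1 : ℝ) ≤ m := ht1.trans htm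
  have hR1 : (1 : ℝ) ≤ R := by exact_mod_cast hR
  let cell : ι → Fin d → ℤ := fun i j => ⌊x i j * m⌋
  let T : Finset (Fin d → ℤ) := Fintype.piFinset fun _ => Finset.Icc (-(m * R : ℤ)) (m * R)
  have hmaps : ∀ i ∈ S, cell i ∈ T := by
    intro i hi
    simp only [T, Fintype.mem_piFinset, Finset.mem_Icc, cell]
    intro j
    have h1 : |x i j| ≤ R := by
      simpa using (PiLp.norm_apply_le (x i) j).trans (hx i hi)
    rw [abs_le] at h1
    constructor
    · rw [Int.le_floor]
      push_cast
      nlinarith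
    · rw [← Int.cast_le (R := ℝ)]
      refine (Int.floor_le _).trans ?_
      push_cast
      nlinarith
  have hT : (T.card : ℝ) ≤ (6 * R) ^ d * M := by
    have : T.card = (2 * (m * R) + 1) ^ d := by
      simp only [T, Fintype.card_piFinset, Int.card_Icc, Finset.prod_const, Finset.card_univ,
        Fintype.card_fin]
      congr 1
      omega
    rw [this, ← htd, ← mul_pow]
    push_cast
    gcongr
    nlinarith
  have hcard : T.card * a < S.card := by
    rw [← Nat.cast_lt (α := ℝ)]
    refine lt_of_lt_of_le ?_ hS
    push_cast
    have : 0 < (6 * R : ℝ) ^ d * M := by positivity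
    have ha : (0 : ℝ) ≤ a := by positivity
    nlinarith [mul_le_mul_of_nonneg_right hT ha]
  obtain ⟨y, -, hy⟩ := Finset.exists_lt_card_fiber_of_mul_lt_card_of_maps_to hmaps hcard
  obtain ⟨U, hU, hUc⟩ := Finset.exists_subset_card_eq (Nat.succ_le_of_lt hy)
  have hU' : ∀ i ∈ U, i ∈ S ∧ cell i = y := fun i hi => by simpa using hU hi
  let e := (U.equivFinOfCardEq hUc).symm
  refine ⟨fun i => e i, Subtype.val_injective.comp e.injective, fun i => (hU' _ (e i).2).1,
    fun i j => ?_⟩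
  refine EuclideanSpace.norm_le_card_mul (by positivity) _ fun k => ?_
  have hc : cell (e i) k = cell (e j) k := by
    rw [(hU' _ (e i).2).2, (hU' _ (e j).2).2]
  have := Int.abs_sub_lt_one_of_floor_eq_floor hc
  rw [← sub_mul, abs_mul, Nat.abs_cast, ← lt_div_iff₀ (by positivity), one_div] at this
  rw [Real.rpow_neg hM0.le, ← ht, PiLp.sub_apply]
  exact this.le.trans (inv_anti₀ (by positivity) htm)

/-- Any large family of points in a ball of radius `R` in `ℝ^d` contains `d` points which
together with the origin span a simplex of volume `O(M ^ (-α))`, where the number of points is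
proportional to `M`. -/
def HasSmallSimplices (R d : ℕ) (α : ℝ) : Prop :=
  ∃ C : ℝ, 0 < C ∧ ∃ K : ℕ, 0 < K ∧
    ∀ (ι : Type) (S : Finset ι) (x : ι → EuclideanSpace ℝ (Fin d)), (∀ i ∈ S, ‖x i‖ ≤ R) →
      ∀ M : ℝ, 1 ≤ M → K * M ≤ S.card →
        ∃ f : Fin d → ι, Function.Injective f ∧ (∀ i, f i ∈ S) ∧
          vol (x ∘ f) ≤ C * M ^ (-α)

namespace HasSmallSimplices

theorem zero (R d : ℕ) (hR : 0 < R) : HasSmallSimplices R d 0 := by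
  refine ⟨d.factorial * R ^ d, by positivity, d + 1, by omega, fun ι S x hx M hM hS => ?_⟩
  have hdS : d ≤ S.card := by
    rw [← Nat.cast_le (α := ℝ)]
    push_cast at hS
    have : (0 : ℝ) ≤ d := by positivity
    nlinarith
  obtain ⟨U, hU, hUc⟩ := Finset.exists_subset_card_eq hdS
  let e := (U.equivFinOfCardEq hUc).symm
  refine ⟨fun i => e i, Subtype.val_injective.comp e.injective, fun i => hU (e i).2, ?_⟩
  simpa using vol_le_factorial_mul_pow (x ∘ fun i => (e i : ι)) fun i => hx _ (hU (e i).2)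

theorem mono {R d : ℕ} {α β : ℝ} (h : HasSmallSimplices R d α) (hβ : β ≤ α) :
    HasSmallSimplices R d β := by
  obtain ⟨C, hC, K, hK, H⟩ := h
  refine ⟨C, hC, K, hK, fun ι S x hx M hM hS => ?_⟩
  obtain ⟨f, hf, hfS, hv⟩ := H ι S x hx M hM hS
  refine ⟨f, hf, hfS, hv.trans ?_⟩
  gcongr

theorem add_cluster {R d : ℕ} (hR : 0 < R) {α : ℝ} (h : HasSmallSimplices R d α) (a : ℕ) :
    HasSmallSimplices R (a + 1 + d) (α + a / (a + 1 + d)) := by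
  classical
  obtain ⟨C, hC, K, hK, H⟩ := h
  set D : ℕ := a + 1 + d with hD
  refine ⟨(a + 1).factorial * (R * D ^ a) * C, by positivity,
    (a + 1) * (6 * R) ^ D + K + (a + 1), by omega, fun ι S x hx M hM hS => ?_⟩
  have hM0 : 0 < M := by linarith
  push_cast at hS
  obtain ⟨g, hg, hgS, hgr⟩ := exists_injective_cluster (by omega : 0 < D) hR a S x hx hM
    (by
      refine le_trans ?_ hS
      gcongr
      have : (0 : ℝ) ≤ K := by positivity
      linarith)
  obtain ⟨π, hπ, hvol⟩ := exists_projection_vol_append_le (x ∘ g) (hx _ (hgS 0))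
    fun i => hgr i.succ 0
  let S' : Finset ι := S \ Finset.univ.image g
  have hS' : (K : ℝ) * M ≤ S'.card := by
    have h1 : S.card ≤ S'.card + (a + 1) := by
      have := Finset.le_card_sdiff (Finset.univ.image g) S
      have h2 : (Finset.univ.image g).card ≤ a + 1 := by
        simpa using Finset.card_image_le (s := Finset.univ) (f := g)
      simp only [S']
      omega
    have h1' : (S.card : ℝ) ≤ S'.card + (a + 1) := by exact_mod_cast h1
    have h3 : 0 ≤ ((a + 1) * (6 * R) ^ D : ℝ) * M := by positivity
    have h4 : (a + 1 : ℝ) ≤ (a + 1) * M := le_mul_of_one_le_right (by positivity) hM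
    linarith
  obtain ⟨f, hf, hfS, hfv⟩ := H ι S' (π ∘ x)
    (fun i hi => (hπ _).trans (hx i (Finset.sdiff_subset hi))) M hM hS'
  have hfS' : ∀ i, f i ∈ S ∧ ∀ j, g j ≠ f i := fun i => by
    simpa [S'] using hfS i
  refine ⟨Fin.append g f, Fin.append_injective_iff.2 ⟨hg, hf, fun i j => (hfS' j).2 i⟩,
    fun i => ?_, ?_⟩
  · refine Fin.addCases (fun i => ?_) (fun i => ?_) i
    · simpa using hgS i
    · simpa using (hfS' i).1
  · have hcomp : x ∘ Fin.append g f = Fin.append (x ∘ g) (x ∘ f) := by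
      funext i
      refine Fin.addCases (fun i => ?_) (fun i => ?_) i <;> simp
    rw [hcomp]
    refine (hvol (x ∘ f)).trans ?_
    refine (mul_le_mul_of_nonneg_left hfv (by positivity)).trans_eq ?_
    have hpow : (M ^ (-(D : ℝ)⁻¹)) ^ a = M ^ (-(a / (a + 1 + d) : ℝ)) := by
      rw [← Real.rpow_natCast, ← Real.rpow_mul hM0.le]
      congr 1
      rw [hD]
      push_cast
      ring
    rw [mul_pow, hpow, neg_add, Real.rpow_add hM0]
    ring

end HasSmallSimplices

theorem neg_add_sq_le_log_one_sub {u : ℝ} (h0 : 0 ≤ u) (h : u ≤ 1 / 2) :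
    -(u + u ^ 2) ≤ Real.log (1 - u) := by
  rw [Real.le_log_iff_exp_le (by linarith), Real.exp_neg]
  have h1 := Real.quadratic_le_exp_of_nonneg (by positivity : 0 ≤ u + u ^ 2)
  refine (inv_anti₀ (by positivity) h1).trans ?_
  rw [inv_le_iff_one_le_mul₀ (by positivity)]
  have h2 : 2 * u ≤ (1 - u) * (1 + u) ^ 2 := by nlinarith [mul_nonneg h0 h0]
  nlinarith [mul_le_mul_of_nonneg_left h2 (sq_nonneg u)]

theorem log_add_five_div_sqrt_le_six {D : ℕ} (h1 : 1 ≤ D) (h16 : D ≤ 16) :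
    Real.log D + 5 / √D ≤ 6 := by
  have hlog : ∀ k : ℕ, D ≤ 2 ^ k → Real.log D ≤ k * Real.log 2 := fun k hk => by
    rw [← Real.log_pow]
    exact Real.log_le_log (by exact_mod_cast h1) (by exact_mod_cast hk)
  have h2 := Real.log_two_lt_d9
  rcases Nat.lt_or_ge 2 D with h | h
  · have h4 := hlog 4 (by simpa using h16)
    have h3 : (3 : ℝ) ≤ D := by exact_mod_cast h
    have hs : (17 / 10 : ℝ) ≤ √D := Real.le_sqrt_of_sq_le (by linarith)
    have : 5 / √D ≤ 3 := by
      rw [div_le_iff₀ (by linarith)]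
      linarith
    push_cast at h4
    linarith
  · have h4 := hlog 1 (by simpa using h)
    have hs : (1 : ℝ) ≤ √D := Real.one_le_sqrt.2 (by exact_mod_cast h1)
    have : 5 / √D ≤ 5 := div_le_self (by norm_num) hs
    push_cast at h4
    linarith

theorem log_add_five_div_sqrt_step {D s : ℝ} (hD : 0 < D) (hs1 : √D ≤ s) (hs2 : s ≤ 2 * √D)
    (hs : s ≤ D / 2) :
    Real.log D + 5 / √D ≤ Real.log (D - s) + 5 / √(D - s) + (s - 1) / D := by
  set t := √D with ht
  have ht0 : 0 < t := Real.sqrt_pos.2 hD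
  have htD : t ^ 2 = D := Real.sq_sqrt hD.le
  have hs0 : 0 < s := by linarith
  have hlog : Real.log D - (s / D + (s / D) ^ 2) ≤ Real.log (D - s) := by
    have h1 : D - s = D * (1 - s / D) := by field_simp
    have h2 : s / D ≤ 1 / 2 := by
      rw [div_le_iff₀ hD]
      linarith
    rw [h1, Real.log_mul hD.ne' (by linarith)]
    linarith [neg_add_sq_le_log_one_sub (by positivity) h2]
  have hsqrt : 5 / t + 5 * s / (2 * t ^ 3) ≤ 5 / √(D - s) := by
    have hq : 0 < √(D - s) := Real.sqrt_pos.2 (by linarith)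
    have hle : √(D - s) ≤ t - s / (2 * t) := by
      apply Real.sqrt_le_iff.2
      have hst : s / (2 * t) * (2 * t) = s := by field_simp
      constructor
      · rw [sub_nonneg, div_le_iff₀ (by positivity)]
        nlinarith
      · nlinarith [sq_nonneg (s / (2 * t))]
    have hpos : 0 < t - s / (2 * t) := hq.trans_le hle
    refine le_trans ?_ (div_le_div_of_nonneg_left (by norm_num) hq hle)
    rw [le_div_iff₀ hpos]
    have : (5 / t + 5 * s / (2 * t ^ 3)) * (t - s / (2 * t)) = 5 - 5 * s ^ 2 / (4 * t ^ 4) := by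
      field_simp
      ring
    rw [this]
    have : 0 ≤ 5 * s ^ 2 / (4 * t ^ 4) := by positivity
    linarith
  have hkey : (s / D) ^ 2 + 1 / D ≤ 5 * s / (2 * t ^ 3) := by
    rw [← htD]
    have : (s / t ^ 2) ^ 2 + 1 / t ^ 2 = (2 * s ^ 2 + 2 * t ^ 2) / (2 * t ^ 4) := by
      field_simp
    rw [this, div_le_div_iff₀ (by positivity) (by positivity)]
    have h3 : 2 * s ^ 2 + 2 * t ^ 2 ≤ 5 * s * t := by
      nlinarith [mul_nonneg (sub_nonneg.2 hs1) (sub_nonneg.2 hs2)]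
    have h4 : 0 < 2 * t ^ 3 := by positivity
    nlinarith [mul_le_mul_of_nonneg_right h3 h4.le]
  have : (s - 1) / D = s / D - 1 / D := sub_div _ _ _
  linarith

theorem hasSmallSimplices_log {R : ℕ} (hR : 0 < R) {d : ℕ} (hd : 1 ≤ d) :
    HasSmallSimplices R d (Real.log d + 5 / √d - 6) := by
  induction d using Nat.strong_induction_on with
  | _ d ih =>
    rcases Nat.lt_or_ge 16 d with h | h
    · have hd16 : (16 : ℝ) < d := by exact_mod_cast h
      have ht4 : (4 : ℝ) ≤ √d := Real.le_sqrt_of_sq_le (by linarith)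
      have htd : √(d : ℝ) * √d = d := Real.mul_self_sqrt (by positivity)
      obtain ⟨a, ha⟩ : ∃ a, ⌈√(d : ℝ)⌉₊ = a + 1 :=
        Nat.exists_eq_succ_of_ne_zero (Nat.ceil_pos.2 (by linarith)).ne'
      have hs1 : √(d : ℝ) ≤ a + 1 := by exact_mod_cast ha ▸ Nat.le_ceil √(d : ℝ)
      have hs2 : (a + 1 : ℝ) < √d + 1 := by
        exact_mod_cast ha ▸ Nat.ceil_lt_add_one (Real.sqrt_nonneg (d : ℝ))
      have had : (a + 1 : ℝ) ≤ d / 2 := by nlinarith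
      have had' : a + 1 < d := by
        rw [← Nat.cast_lt (α := ℝ)]
        push_cast
        linarith
      obtain ⟨e, rfl⟩ := Nat.exists_eq_add_of_le had'.le
      have := (ih e (by omega) (by omega)).add_cluster hR a
      refine this.mono ?_
      have key := log_add_five_div_sqrt_step (by linarith) hs1 (by linarith) had
      have he : ((a + 1 + e : ℕ) : ℝ) - (a + 1) = e := by
        push_cast
        ring
      rw [he] at key
      push_cast at key ⊢
      rw [add_sub_cancel_right] at key
      linarith
    · exact (HasSmallSimplices.zero R d hR).mono (by linarith [log_add_five_div_sqrt_le_six hd h])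

theorem simplexVol_nonneg {d k : ℕ} (p : Fin (k + 1) → EuclideanSpace ℝ (Fin d)) :
    0 ≤ simplexVol p :=
  mul_nonneg (by positivity) (Real.sqrt_nonneg _)

theorem Delta_le_of_exists {k d n : ℕ} {B : ℝ} (hB : 0 ≤ B)
    (h : ∀ X : Finset (EuclideanSpace ℝ (Fin d)), X.card = n →
      (∀ x ∈ X, ∀ i, x i ∈ Set.Icc (0 : ℝ) 1) →
      ∃ p : Fin (k + 1) → EuclideanSpace ℝ (Fin d),
        Function.Injective p ∧ (∀ i, p i ∈ X) ∧ simplexVol p ≤ B) :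
    Delta k d n ≤ B := by
  refine Real.sSup_le ?_ hB
  rintro v ⟨X, hXn, hX, rfl⟩
  obtain ⟨p, hp, hpX, hpB⟩ := h X hXn hX
  refine le_trans (csInf_le ?_ ⟨p, hp, hpX, rfl⟩) hpB
  refine ⟨0, ?_⟩
  rintro _ ⟨q, -, -, rfl⟩
  exact simplexVol_nonneg q

theorem norm_sub_le_of_mem_unitCube {d : ℕ} {x y : EuclideanSpace ℝ (Fin d)}
    (hx : ∀ i, x i ∈ Set.Icc (0 : ℝ) 1) (hy : ∀ i, y i ∈ Set.Icc (0 : ℝ) 1) : ‖x - y‖ ≤ d := by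
  simpa using EuclideanSpace.norm_le_card_mul zero_le_one (x - y) fun i => by
    simpa using abs_sub_le_of_le_of_le (hx i).1 (hx i).2 (hy i).1 (hy i).2

theorem simplexVol_cons_le {d : ℕ} (z : EuclideanSpace ℝ (Fin d))
    (f : Fin d → EuclideanSpace ℝ (Fin d)) :
    simplexVol (Fin.cons z f) ≤ vol ((fun x => x - z) ∘ f) :=
  mul_le_of_le_one_left (Real.sqrt_nonneg _)
    (inv_le_one_of_one_le₀ (by exact_mod_cast d.factorial_pos))

/-- The case of the bound in which the exponent carries no information. -/
theorem exists_simplexVol_le_factorial_mul_pow {d : ℕ} {X : Finset (EuclideanSpace ℝ (Fin d))}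
    (hXd : d + 1 ≤ X.card) (hX : ∀ x ∈ X, ∀ i, x i ∈ Set.Icc (0 : ℝ) 1) :
    ∃ p : Fin (d + 1) → EuclideanSpace ℝ (Fin d),
      Function.Injective p ∧ (∀ i, p i ∈ X) ∧ simplexVol p ≤ d.factorial * (d : ℝ) ^ d := by
  obtain ⟨U, hU, hUc⟩ := Finset.exists_subset_card_eq hXd
  let e := (U.equivFinOfCardEq hUc).symm
  let p : Fin (d + 1) → EuclideanSpace ℝ (Fin d) := fun i => e i
  have hp : ∀ i, p i ∈ X := fun i => hU (e i).2
  refine ⟨p, Subtype.val_injective.comp e.injective, hp, ?_⟩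
  rw [← Fin.cons_self_tail p]
  exact (simplexVol_cons_le _ _).trans <| vol_le_factorial_mul_pow _ fun i =>
    norm_sub_le_of_mem_unitCube (hX _ (hp _)) (hX _ (hp _))

theorem HasSmallSimplices.exists_simplexVol_le {d : ℕ} {α : ℝ} (h : HasSmallSimplices d d α) :
    ∃ C : ℝ, 0 < C ∧ ∃ K : ℕ, 0 < K ∧ ∀ X : Finset (EuclideanSpace ℝ (Fin d)),
      (∀ x ∈ X, ∀ i, x i ∈ Set.Icc (0 : ℝ) 1) → ∀ M : ℝ, 1 ≤ M → K * M ≤ X.card →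
      ∃ p : Fin (d + 1) → EuclideanSpace ℝ (Fin d),
        Function.Injective p ∧ (∀ i, p i ∈ X) ∧ simplexVol p ≤ C * M ^ (-α) := by
  classical
  obtain ⟨C, hC, K, hK, H⟩ := h
  refine ⟨C, hC, K + 1, by omega, fun X hX M hM hXM => ?_⟩
  push_cast at hXM
  have hX0 : 0 < X.card := by
    rw [← Nat.cast_pos (α := ℝ)]
    refine lt_of_lt_of_le ?_ hXM
    positivity
  obtain ⟨z, hz⟩ := Finset.card_pos.1 hX0
  obtain ⟨f, hf, hfX, hfv⟩ := H _ (X.erase z) (fun x => x - z)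
    (fun x hx => norm_sub_le_of_mem_unitCube (hX x (Finset.mem_of_mem_erase hx)) (hX z hz)) M hM
    (by
      rw [Finset.card_erase_of_mem hz, Nat.cast_sub hX0]
      push_cast
      linarith)
  refine ⟨Fin.cons z f, Fin.cons_injective_iff.2 ⟨?_, hf⟩, fun i => ?_,
    (simplexVol_cons_le z f).trans hfv⟩
  · rintro ⟨i, rfl⟩
    exact Finset.notMem_erase _ _ (hfX i)
  · refine Fin.cases ?_ (fun i => ?_) i
    · simpa using hz
    · simpa using Finset.mem_of_mem_erase (hfX i)

/-- **Corollary 1.** For every `d ≥ 3` there is a constant `C_d > 0` such that for all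
`n ≥ d + 1`, `Δ_{d,d}(n) ≤ C_d · n^(6 - ln d)`: every `n`-element subset of `[0,1]^d`
contains `d+1` points spanning a simplex of volume at most `C_d · n^(-ln d + 6)`. -/
theorem delta_log_bound (d : ℕ) (hd : 3 ≤ d) :
    ∃ C : ℝ, 0 < C ∧ ∀ n : ℕ, d + 1 ≤ n →
      Delta d d n ≤ C * (n : ℝ) ^ ((6 : ℝ) - Real.log d) := by
  have hV : (0 : ℝ) < d.factorial * (d : ℝ) ^ d := by positivity
  rcases le_total (Real.log d) 6 with hlog | hlog
  · refine ⟨_, hV, fun n hn => ?_⟩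
    refine (Delta_le_of_exists hV.le fun X hXn hX =>
      exists_simplexVol_le_factorial_mul_pow (hXn ▸ hn) hX).trans ?_
    exact le_mul_of_one_le_right hV.le (Real.one_le_rpow
      (by exact_mod_cast (by omega : 1 ≤ n)) (by linarith))
  · obtain ⟨C, hC, K, hK, H⟩ := ((hasSmallSimplices_log (by omega : 0 < d) (by omega : 1 ≤ d)).mono
      (β := Real.log d - 6) (by have : 0 ≤ 5 / √(d : ℝ) := by positivity
                                linarith)).exists_simplexVol_le
    have hK0 : (0 : ℝ) < K := by exact_mod_cast hK
    set V : ℝ := d.factorial * (d : ℝ) ^ d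
    refine ⟨(C + V) * (K : ℝ) ^ (Real.log d - 6), by positivity, fun n hn => ?_⟩
    have hn0 : (0 : ℝ) < n := by exact_mod_cast (by omega : 0 < n)
    have hscale : (C + V) * (K : ℝ) ^ (Real.log d - 6) * (n : ℝ) ^ ((6 : ℝ) - Real.log d) =
        (C + V) * (n / K : ℝ) ^ (-(Real.log d - 6)) := by
      rw [Real.div_rpow hn0.le hK0.le, Real.rpow_neg hK0.le, neg_sub, div_inv_eq_mul]
      ring
    rw [hscale]
    refine Delta_le_of_exists (by positivity) fun X hXn hX => ?_
    rcases le_total 1 (n / K : ℝ) with h1 | h1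
    · obtain ⟨p, hp, hpX, hpv⟩ := H X hX _ h1 (by rw [mul_div_cancel₀ _ hK0.ne', hXn])
      refine ⟨p, hp, hpX, hpv.trans ?_⟩
      gcongr
      linarith
    · obtain ⟨p, hp, hpX, hpv⟩ := exists_simplexVol_le_factorial_mul_pow (hXn ▸ hn) hX
      refine ⟨p, hp, hpX, hpv.trans ?_⟩
      have : 1 ≤ (n / K : ℝ) ^ (-(Real.log d - 6)) :=
        Real.one_le_rpow_of_pos_of_le_one_of_nonpos (by positivity) h1 (by linarith)
      nlinarith
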